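/- There is an absolute constant c > 0 such that for every Banach space X, every finite interval w' ⊂ ℝ, every f ∈ L_1(w'; X) and every real α ≥ 0, ‖f̂_{w'}(α)‖_X ≤ c · C_{[α]}(f, w'), where [α] denotes the integer part of α. Consequently, each averaged value (1/|w'|)∫_{w'} f(t) e^{−2πikt} dt (for k ≥ 0 real, with α = k|w'|) has norm at most c · C_{[k|w'|]}(f, w'). -/

import Mathlib

open MeasureTheory Filter Set Topology Real
open scoped ENNReal NNReal

noncomputable section

universe u
section
variable {X : Type*} [NormedAddCommGroup X] [NormedSpace ℂ X]

/-- Generalized Fourier coefficient on the interval `w = (a,b)`: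
`f̂_w(α) = (1/|w|) ∫_w f(t) e^{-2πiαt/|w|} dt`. -/
def intervalFourierCoeff (f : ℝ → X) (a b : ℝ) (α : ℝ) : X :=
  (b - a)⁻¹ • ∫ t in Ioo a b,
    Complex.exp (-(2 * (π : ℂ) * Complex.I * (α : ℂ) * (t : ℂ)) / ((b : ℂ) - (a : ℂ))) • f t

/-- `X` has Fourier type `p` with constant `c`. -/
def HasFourierTypeWith (X : Type*) [NormedAddCommGroup X] [NormedSpace ℂ X]
    (p c : ℝ) : Prop :=
  ∀ a b : ℝ, a < b → ∀ f : ℝ → X, AEStronglyMeasurable f (volume.restrict (Ioo a b)) →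
    (∑' k : ℤ, (‖intervalFourierCoeff f a b k‖₊ : ℝ≥0∞) ^ (p / (p - 1))) ^ ((p - 1) / p)
      ≤ ENNReal.ofReal c *
        ((ENNReal.ofReal (b - a))⁻¹ * ∫⁻ t in Ioo a b, (‖f t‖₊ : ℝ≥0∞) ^ p) ^ (1 / p)

/-- `log⁺ u = max (log u) 0`. -/
def logPlus (u : ℝ) : ℝ := max (Real.log u) 0

/-- The normalized `L (log L)^β` "norm" `(1/|w|) ∫_w ‖f‖ (log⁺‖f‖)^β` on `w = (a,b)`. -/
def avgLlogL (f : ℝ → X) (β a b : ℝ) : ℝ≥0∞ :=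
  (ENNReal.ofReal (b - a))⁻¹ *
    ∫⁻ x in Ioo a b, ENNReal.ofReal (‖f x‖ * logPlus ‖f x‖ ^ β)

/-- Carleson average `C_k(f,w) = γ⁻¹ Σ_μ ‖f̂_w(k+μ/3)‖/(1+μ²)`. -/
def carlesonAvg (f : ℝ → X) (a b : ℝ) (k : ℤ) : ℝ :=
  (∑' μ : ℤ, (1 + (μ : ℝ) ^ 2)⁻¹)⁻¹ *
    ∑' μ : ℤ, ‖intervalFourierCoeff f a b ((k : ℝ) + (μ : ℝ) / 3)‖ / (1 + (μ : ℝ) ^ 2)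
end

/-- The antiderivative identity for `exp (c * x)`, valid also at `c = 0`. -/
lemma mul_integral_exp_mul (c : ℂ) (a b : ℝ) :
    c * ∫ x in a..b, Complex.exp (c * x) = Complex.exp (c * b) - Complex.exp (c * a) := by
  rcases eq_or_ne c 0 with rfl | hc
  · simp
  · rw [integral_exp_mul_complex hc]
    field_simp

/-- Fourier coefficients over the period `[-L, L]` of the even function `exp (-i a |x|)`. -/
lemma integral_exp_mul_exp_abs (a b L : ℝ) (hL : 0 ≤ L)
    (hper : Complex.exp (-(Complex.I * b * L)) = Complex.exp (Complex.I * b * L)) :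
    ((b : ℂ) ^ 2 - (a : ℂ) ^ 2) * ∫ x in (-L)..L, Complex.exp (-(Complex.I * b * x)) *
        Complex.exp (-(Complex.I * a * |x|)) =
      2 * Complex.I * a * (1 - Complex.exp (-(Complex.I * a * L)) *
        Complex.exp (Complex.I * b * L)) := by
  have hcont : Continuous fun x : ℝ => Complex.exp (-(Complex.I * b * x)) *
      Complex.exp (-(Complex.I * a * ((|x| : ℝ) : ℂ))) := by fun_prop
  rw [← intervalIntegral.integral_add_adjacent_intervals
    (hcont.intervalIntegrable (-L) 0) (hcont.intervalIntegrable 0 L)]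
  have hneg : ∫ x in (-L)..0, Complex.exp (-(Complex.I * b * x)) *
      Complex.exp (-(Complex.I * a * ((|x| : ℝ) : ℂ))) =
      ∫ x in (-L)..0, Complex.exp ((-(Complex.I * (b - a))) * x) := by
    refine intervalIntegral.integral_congr fun x hx => ?_
    rw [uIcc_of_le (by linarith)] at hx
    simp only [abs_of_nonpos hx.2, ← Complex.exp_add]
    congr 1
    push_cast
    ring
  have hpos : ∫ x in (0)..L, Complex.exp (-(Complex.I * b * x)) *
      Complex.exp (-(Complex.I * a * ((|x| : ℝ) : ℂ))) =
      ∫ x in (0)..L, Complex.exp ((-(Complex.I * (b + a))) * x) := by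
    refine intervalIntegral.integral_congr fun x hx => ?_
    rw [uIcc_of_le hL] at hx
    simp only [abs_of_nonneg hx.1, ← Complex.exp_add]
    congr 1
    ring
  rw [hneg, hpos]
  have e1 := mul_integral_exp_mul (-(Complex.I * (b - a))) (-L) 0
  have e2 := mul_integral_exp_mul (-(Complex.I * (b + a))) 0 L
  have f1 : Complex.exp (-(Complex.I * (b - a)) * ((-L : ℝ) : ℂ)) =
      Complex.exp (-(Complex.I * a * L)) * Complex.exp (Complex.I * b * L) := by
    rw [← Complex.exp_add]
    congr 1
    push_cast
    ring
  have f2 : Complex.exp (-(Complex.I * (b + a)) * (L : ℂ)) =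
      Complex.exp (-(Complex.I * a * L)) * Complex.exp (Complex.I * b * L) := by
    rw [← hper, ← Complex.exp_add]
    congr 1
    ring
  rw [f1, Complex.ofReal_zero, mul_zero, Complex.exp_zero] at e1
  rw [f2, Complex.ofReal_zero, mul_zero, Complex.exp_zero] at e2
  linear_combination (Complex.I * (b + a)) * e1 + (Complex.I * (b - a)) * e2 +
    ((b : ℂ) ^ 2 - (a : ℂ) ^ 2) * ((∫ x in (-L)..0, Complex.exp (-(Complex.I * (b - a)) * x)) +
      ∫ x in (0)..L, Complex.exp (-(Complex.I * (b + a)) * x)) *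
      Complex.I_sq

lemma norm_exp_neg_I_mul_ofReal_mul_ofReal (a x : ℝ) :
    ‖Complex.exp (-(Complex.I * a * x))‖ = 1 := by
  simp [Complex.norm_exp]

lemma summable_one_add_int_sq_inv : Summable fun μ : ℤ => (1 + (μ : ℝ) ^ 2)⁻¹ := by
  refine (summable_one_div_int_pow.mpr one_lt_two).of_norm_bounded_eventually ?_
  filter_upwards [(Set.finite_singleton (0 : ℤ)).compl_mem_cofinite] with μ hμ
  have hμ0 : (μ : ℝ) ≠ 0 := by exact_mod_cast hμ
  rw [Real.norm_of_nonneg (by positivity), one_div]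
  gcongr
  linarith

/-- On `[0, 1]` the character `exp (-2πiδu)`, `0 ≤ δ ≤ 1`, is a combination of the characters
of period `3` with coefficients decaying quadratically, uniformly in `δ`. -/
lemma exists_hasSum_exp_of_mem_Icc {δ : ℝ} (hδ : δ ∈ Icc (0 : ℝ) 1) :
    ∃ c : ℤ → ℂ, (∀ μ, ‖c μ‖ ≤ 13 * (1 + (μ : ℝ) ^ 2)⁻¹) ∧ ∀ u ∈ Icc (0 : ℝ) 1,
      HasSum (fun μ : ℤ => c μ * Complex.exp (-(2 * π * Complex.I * (μ / 3) * u)))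
        (Complex.exp (-(2 * π * Complex.I * δ * u))) := by
  have : Fact ((0 : ℝ) < 3) := ⟨by norm_num⟩
  set g : ℝ → ℂ := fun x => Complex.exp (-(Complex.I * ((2 * π * δ : ℝ) : ℂ) * ((|x| : ℝ) : ℂ)))
    with hg
  have hgc : Continuous g := by fun_prop
  set F : C(AddCircle (3 : ℝ), ℂ) := ⟨AddCircle.liftIco 3 (-(3 / 2)) g,
    AddCircle.liftIco_continuous (by
      simp only [hg]
      rw [show (-(3 / 2) + 3 : ℝ) = 3 / 2 by norm_num, abs_neg]) hgc.continuousOn⟩ with hF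
  have hFg : ∀ x ∈ Ico (-(3 / 2) : ℝ) (-(3 / 2) + 3), F (x : AddCircle (3 : ℝ)) = g x := by
    intro x hx
    rw [hF, ContinuousMap.coe_mk]
    exact AddCircle.liftIco_coe_apply (f := g) hx
  have hcoeff : ∀ μ : ℤ, fourierCoeff F μ = (1 / 3 : ℝ) • ∫ x in (-(3 / 2) : ℝ)..(3 / 2),
      Complex.exp (-(Complex.I * ((2 * π * μ / 3 : ℝ) : ℂ) * x)) *
        Complex.exp (-(Complex.I * ((2 * π * δ : ℝ) : ℂ) * ((|x| : ℝ) : ℂ))) := by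
    intro μ
    rw [fourierCoeff_eq_intervalIntegral _ _ (-(3 / 2)),
      show (-(3 / 2) + 3 : ℝ) = 3 / 2 by norm_num]
    congr 1
    refine intervalIntegral.integral_congr_Ioo_of_le (by norm_num) fun x hx => ?_
    have hFx : F (x : AddCircle (3 : ℝ)) = g x :=
      hFg x ⟨hx.1.le, by linarith [hx.2]⟩
    simp only [hFx, hg, smul_eq_mul, fourier_coe_apply]
    congr 2
    push_cast
    ring
  have hbound : ∀ μ : ℤ, ‖fourierCoeff F μ‖ ≤ 13 * (1 + (μ : ℝ) ^ 2)⁻¹ := by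
    intro μ
    set a : ℝ := 2 * π * δ with ha
    set b : ℝ := 2 * π * μ / 3 with hb
    set J : ℂ := ∫ x in (-(3 / 2) : ℝ)..(3 / 2), Complex.exp (-(Complex.I * b * x)) *
        Complex.exp (-(Complex.I * a * ((|x| : ℝ) : ℂ))) with hJ
    have hJ3 : ‖J‖ ≤ 3 := by
      have := intervalIntegral.norm_integral_le_of_norm_le_const (a := (-(3 / 2) : ℝ))
        (b := 3 / 2) (C := 1) (f := fun x : ℝ => Complex.exp (-(Complex.I * b * x)) *
        Complex.exp (-(Complex.I * a * ((|x| : ℝ) : ℂ)))) (fun x _ => by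
          rw [norm_mul, norm_exp_neg_I_mul_ofReal_mul_ofReal,
            norm_exp_neg_I_mul_ofReal_mul_ofReal, mul_one])
      norm_num at this
      exact this
    have hper : Complex.exp (-(Complex.I * b * ((3 / 2 : ℝ) : ℂ))) =
        Complex.exp (Complex.I * b * ((3 / 2 : ℝ) : ℂ)) := by
      rw [Complex.exp_eq_exp_iff_exists_int]
      refine ⟨-μ, ?_⟩
      rw [hb]
      push_cast
      ring
    have key := integral_exp_mul_exp_abs a b (3 / 2) (by norm_num) hper
    rw [← hJ] at key
    have ha0 : 0 ≤ a := by have := hδ.1; positivity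
    have haπ : a ≤ 2 * π := by nlinarith [hδ.2, pi_pos]
    have hE : ‖2 * Complex.I * a * (1 - Complex.exp (-(Complex.I * a * ((3 / 2 : ℝ) : ℂ))) *
        Complex.exp (Complex.I * b * ((3 / 2 : ℝ) : ℂ)))‖ ≤ 4 * a := by
      have h1 : ‖1 - Complex.exp (-(Complex.I * a * ((3 / 2 : ℝ) : ℂ))) *
          Complex.exp (Complex.I * b * ((3 / 2 : ℝ) : ℂ))‖ ≤ 2 := by
        refine (norm_sub_le _ _).trans ?_
        rw [← hper, norm_mul, norm_exp_neg_I_mul_ofReal_mul_ofReal,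
          norm_exp_neg_I_mul_ofReal_mul_ofReal, norm_one]
        norm_num
      rw [norm_mul]
      have h2 : ‖2 * Complex.I * (a : ℂ)‖ = 2 * a := by
        simp [abs_of_nonneg ha0]
      rw [h2]
      nlinarith
    rw [← key] at hE
    have hb2 : b ^ 2 * ‖J‖ ≤ 4 * a + a ^ 2 * ‖J‖ := by
      have h1 : (b : ℂ) ^ 2 * J = ((b : ℂ) ^ 2 - (a : ℂ) ^ 2) * J + (a : ℂ) ^ 2 * J := by ring
      have h2 : ‖(b : ℂ) ^ 2 * J‖ = b ^ 2 * ‖J‖ := by simp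
      have h3 : ‖(a : ℂ) ^ 2 * J‖ = a ^ 2 * ‖J‖ := by simp
      rw [← h2, h1, ← h3]
      exact (norm_add_le _ _).trans (by gcongr)
    have hμ : (μ : ℝ) ^ 2 * ‖J‖ ≤ 36 := by
      have h1 : b ^ 2 = 4 / 9 * π ^ 2 * (μ : ℝ) ^ 2 := by rw [hb]; ring
      have h2 : a ^ 2 * ‖J‖ ≤ (2 * π) ^ 2 * 3 := by gcongr
      have h3 : π ^ 2 * ((μ : ℝ) ^ 2 * ‖J‖) ≤ π ^ 2 * 36 := by
        rw [h1] at hb2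
        nlinarith [pi_gt_three]
      exact le_of_mul_le_mul_left h3 (by positivity)
    rw [hcoeff, norm_smul, ← div_eq_mul_inv, le_div_iff₀ (by positivity), ← hJ,
      Real.norm_of_nonneg (by norm_num)]
    linarith
  have hsum : Summable (fourierCoeff F) :=
    (summable_one_add_int_sq_inv.mul_left 13).of_norm_bounded hbound
  refine ⟨fun μ => fourierCoeff F (-μ), fun μ => by simpa using hbound (-μ), fun u hu => ?_⟩
  have hs := has_pointwise_sum_fourier_series_of_summable hsum (u : AddCircle (3 : ℝ))
  have hFu : F (u : AddCircle (3 : ℝ)) = g u :=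
    hFg u ⟨by linarith [hu.1], by linarith [hu.2]⟩
  rw [hFu, ← (Equiv.neg ℤ).hasSum_iff] at hs
  convert hs using 1
  · ext μ
    simp only [Function.comp_apply, Equiv.neg_apply, smul_eq_mul, fourier_coe_apply]
    congr 2
    push_cast
    ring
  · simp only [hg, abs_of_nonneg hu.1]
    congr 1
    push_cast
    ring

/-- Rescaling of `exists_hasSum_exp_of_mem_Icc` to an arbitrary interval. -/
lemma exists_hasSum_exp_of_mem_Ioo {a b : ℝ} (hab : a < b) {δ : ℝ} (hδ : δ ∈ Icc (0 : ℝ) 1) :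
    ∃ d : ℤ → ℂ, (∀ μ, ‖d μ‖ ≤ 13 * (1 + (μ : ℝ) ^ 2)⁻¹) ∧ ∀ t ∈ Ioo a b,
      HasSum (fun μ : ℤ => d μ * Complex.exp (-(2 * π * Complex.I * (μ / 3) * t) / (b - a)))
        (Complex.exp (-(2 * π * Complex.I * δ * t) / (b - a))) := by
  obtain ⟨c, hc, hsum⟩ := exists_hasSum_exp_of_mem_Icc hδ
  have hba : 0 < b - a := sub_pos.mpr hab
  have hne : (b : ℂ) - a ≠ 0 := by
    rw [sub_ne_zero]
    exact_mod_cast hab.ne'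
  set s : ℝ := a / (b - a) with hs
  refine ⟨fun μ => c μ * Complex.exp (((2 * π * (μ / 3 - δ) * s : ℝ) : ℂ) * Complex.I),
    fun μ => ?_, fun t ht => ?_⟩
  · rw [norm_mul, Complex.norm_exp_ofReal_mul_I, mul_one]
    exact hc μ
  · have hu : (t - a) / (b - a) ∈ Icc (0 : ℝ) 1 :=
      ⟨div_nonneg (by linarith [ht.1]) hba.le, (div_le_one hba).mpr (by linarith [ht.2])⟩
    convert (hsum _ hu).mul_right (Complex.exp (-(2 * π * Complex.I * δ * s))) using 1
    · rfl
    · ext μ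
      simp only [mul_assoc (c μ), ← Complex.exp_add, hs]
      congr 2
      push_cast
      field_simp
      ring
    · rw [← Complex.exp_add, hs]
      congr 1
      push_cast
      field_simp
      ring

lemma norm_exp_neg_two_pi_I_mul_div (a b α t : ℝ) :
    ‖Complex.exp (-(2 * (π : ℂ) * Complex.I * (α : ℂ) * (t : ℂ)) / ((b : ℂ) - (a : ℂ)))‖ = 1 := by
  rw [← Complex.norm_exp_ofReal_mul_I (-(2 * π * α * t) / (b - a))]
  congr 2
  push_cast
  ring

lemma integrableOn_exp_smul {X : Type*} [NormedAddCommGroup X] [NormedSpace ℂ X] {f : ℝ → X}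
    {a b : ℝ} (hf : IntegrableOn f (Ioo a b) volume) (α : ℝ) :
    IntegrableOn (fun t : ℝ => Complex.exp (-(2 * (π : ℂ) * Complex.I * (α : ℂ) * (t : ℂ)) /
      ((b : ℂ) - (a : ℂ))) • f t) (Ioo a b) volume :=
  Integrable.bdd_smul hf 1 (Continuous.aestronglyMeasurable (by fun_prop))
    (Eventually.of_forall fun t => (norm_exp_neg_two_pi_I_mul_div a b α t).le)

lemma norm_intervalFourierCoeff_le_average {X : Type*} [NormedAddCommGroup X] [NormedSpace ℂ X]
    (f : ℝ → X) {a b : ℝ} (hab : a < b) (α : ℝ) :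
    ‖intervalFourierCoeff f a b α‖ ≤ (b - a)⁻¹ * ∫ t in Ioo a b, ‖f t‖ := by
  have hba : 0 < b - a := sub_pos.mpr hab
  rw [intervalFourierCoeff, norm_smul, Real.norm_of_nonneg (by positivity)]
  gcongr
  refine (norm_integral_le_integral_norm _).trans (le_of_eq ?_)
  simp only [norm_smul, norm_exp_neg_two_pi_I_mul_div, one_mul]

/-- A single generalized Fourier coefficient is controlled by the quadratically weighted sum of
the coefficients at the frequencies `⌊α⌋ + μ / 3`. -/
lemma norm_intervalFourierCoeff_le_tsum {X : Type*} [NormedAddCommGroup X] [NormedSpace ℂ X]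
    [CompleteSpace X] {a b : ℝ} (hab : a < b) {f : ℝ → X}
    (hf : IntegrableOn f (Ioo a b) volume) (α : ℝ) :
    ‖intervalFourierCoeff f a b α‖ ≤
      13 * ∑' μ : ℤ, ‖intervalFourierCoeff f a b ((⌊α⌋ : ℝ) + (μ : ℝ) / 3)‖ /
        (1 + (μ : ℝ) ^ 2) := by
  have hba : 0 < b - a := sub_pos.mpr hab
  obtain ⟨d, hd, hsum⟩ := exists_hasSum_exp_of_mem_Ioo hab (δ := Int.fract α)
    ⟨Int.fract_nonneg α, (Int.fract_lt_one α).le⟩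
  set e : ℝ → ℝ → ℂ := fun β t =>
    Complex.exp (-(2 * (π : ℂ) * Complex.I * (β : ℂ) * (t : ℂ)) / ((b : ℂ) - (a : ℂ))) with he
  have hne (β t : ℝ) : ‖e β t‖ = 1 := norm_exp_neg_two_pi_I_mul_div a b β t
  have hpt : ∀ t ∈ Ioo a b, HasSum (fun μ : ℤ => d μ • e (⌊α⌋ + μ / 3) t • f t) (e α t • f t) := by
    intro t ht
    convert ((hsum t ht).mul_right (e ⌊α⌋ t)).smul_const (f t) using 1
    · ext μ
      simp only [he]
      rw [smul_smul, mul_assoc (d μ), ← Complex.exp_add]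
      congr 3
      push_cast
      ring
    · simp only [he]
      rw [← Complex.exp_add]
      congr 2
      nth_rewrite 1 [← Int.floor_add_fract α]
      push_cast
      ring
  have hsd : Summable fun μ : ℤ => ‖d μ‖ :=
    (summable_one_add_int_sq_inv.mul_left 13).of_nonneg_of_le (fun _ => norm_nonneg _) hd
  have hint := hasSum_integral_of_summable_integral_norm (μ := volume.restrict (Ioo a b))
    (F := fun (μ : ℤ) t => d μ • e (⌊α⌋ + μ / 3) t • f t)
    (fun μ => (integrableOn_exp_smul hf (⌊α⌋ + μ / 3)).smul (d μ)) (by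
      simp only [norm_smul, hne, one_mul, integral_const_mul]
      exact hsd.mul_right _)
  have heq : ∫ t in Ioo a b, ∑' μ : ℤ, d μ • e (⌊α⌋ + μ / 3) t • f t =
      ∫ t in Ioo a b, e α t • f t :=
    setIntegral_congr_fun measurableSet_Ioo fun t ht => (hpt t ht).tsum_eq
  rw [heq] at hint
  have hcoeff := hint.const_smul ((b - a)⁻¹)
  have hS : Summable fun μ : ℤ =>
      ‖intervalFourierCoeff f a b ((⌊α⌋ : ℝ) + (μ : ℝ) / 3)‖ / (1 + (μ : ℝ) ^ 2) := by
    refine (summable_one_add_int_sq_inv.mul_left ((b - a)⁻¹ * ∫ t in Ioo a b, ‖f t‖)).of_nonneg_of_le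
      (fun _ => by positivity) fun μ => ?_
    rw [div_eq_mul_inv]
    gcongr
    exact norm_intervalFourierCoeff_le_average f hab _
  refine hcoeff.norm_le_of_bounded (hS.hasSum.mul_left 13) fun μ => ?_
  rw [integral_smul, smul_comm, norm_smul]
  calc ‖d μ‖ * ‖intervalFourierCoeff f a b ((⌊α⌋ : ℝ) + (μ : ℝ) / 3)‖
      ≤ 13 * (1 + (μ : ℝ) ^ 2)⁻¹ * ‖intervalFourierCoeff f a b ((⌊α⌋ : ℝ) + (μ : ℝ) / 3)‖ := by
        gcongr
        exact hd μ
    _ = _ := by ring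

lemma exists_norm_intervalFourierCoeff_le :
    ∃ c : ℝ, 0 < c ∧ ∀ {X : Type u} [NormedAddCommGroup X] [NormedSpace ℂ X] [CompleteSpace X]
      (a b : ℝ), a < b → ∀ f : ℝ → X, IntegrableOn f (Ioo a b) volume → ∀ α : ℝ,
        ‖intervalFourierCoeff f a b α‖ ≤ c * carlesonAvg f a b ⌊α⌋ := by
  have hγ : 0 < ∑' μ : ℤ, (1 + (μ : ℝ) ^ 2)⁻¹ :=
    summable_one_add_int_sq_inv.tsum_pos (fun _ => by positivity) 0 (by norm_num)
  refine ⟨13 * ∑' μ : ℤ, (1 + (μ : ℝ) ^ 2)⁻¹, by positivity, fun a b hab f hf α => ?_⟩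
  rw [carlesonAvg, mul_assoc, mul_inv_cancel_left₀ hγ.ne']
  exact norm_intervalFourierCoeff_le_tsum hab hf α

/-- cf. Lemma 3.1: there is an absolute constant `c` such that for every Banach
space `X`, every finite interval `w' = (w₁,w₂)`, every `f ∈ L₁(w';X)` and every real `α ≥ 0`,
`‖f̂_{w'}(α)‖ ≤ c · C_{[α]}(f,w')`; consequently, for every real `k ≥ 0`,
`‖(1/|w'|)∫_{w'} f(t) e^{-2πikt} dt‖ ≤ c · C_{[k|w'|]}(f,w')`. -/
theorem statement12 :
    ∃ c : ℝ, 0 < c ∧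
      ∀ (X : Type u) [NormedAddCommGroup X] [NormedSpace ℂ X] [CompleteSpace X]
        (w₁ w₂ : ℝ), w₁ < w₂ →
        ∀ f : ℝ → X, IntegrableOn f (Ioo w₁ w₂) volume →
          (∀ α : ℝ, 0 ≤ α →
            ‖intervalFourierCoeff f w₁ w₂ α‖ ≤ c * carlesonAvg f w₁ w₂ ⌊α⌋) ∧
          (∀ k : ℝ, 0 ≤ k →
            ‖(w₂ - w₁)⁻¹ • ∫ t in Ioo w₁ w₂,
                Complex.exp (-(2 * (π : ℂ) * Complex.I * (k : ℂ) * (t : ℂ))) • f t‖ ≤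
              c * carlesonAvg f w₁ w₂ ⌊k * (w₂ - w₁)⌋) := by
  obtain ⟨C, hC, H⟩ := exists_norm_intervalFourierCoeff_le.{u}
  refine ⟨C, hC, fun X _ _ _ w₁ w₂ hw f hf => ⟨fun α _ => H w₁ w₂ hw f hf α, fun k _ => ?_⟩⟩
  have hne : (w₂ : ℂ) - w₁ ≠ 0 := by
    rw [sub_ne_zero]
    exact_mod_cast hw.ne'
  convert H w₁ w₂ hw f hf (k * (w₂ - w₁)) using 2
  unfold intervalFourierCoeff
  congr 2
  ext t
  congr 2
  push_cast
  field_simp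

end
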